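/- For every pair of reals 0 < v ≤ u there exist constants c, C > 0 depending only on u and v such that for every d ≥ 1, every R = (R_1,…,R_d) with min_j R_j = v and max_j R_j = u, and every n ≥ 1: (i) if 1 ≤ n ≤ d then c ≤ σ_{R,d}(n) ≤ C; (ii) if d ≤ n ≤ 3^d and n ≥ 2 then c·(log(1 + d/log n)/log n)^{1/2} ≤ σ_{R,d}(n) ≤ C·(log(1 + d/log n)/log n)^{1/2}; (iii) if n ≥ 3^d then c·d^{-1/2}·n^{-g(R)} ≤ σ_{R,d}(n) ≤ C·d^{-1/2}·n^{-g(R)}. Here g(R) = (1/R_1+…+1/R_d)^{-1} and log denotes the base-2 logarithm. -/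

import Mathlib

/-- nonincreasing rearrangement of the weights `(1 + Σ_j |k_j|^{2R_j})^{-1/2}`, `k ∈ ℤ^d`. -/
noncomputable def sigmaR (d : ℕ) (R : Fin d → ℝ) (n : ℕ) : ℝ :=
  sSup {t : ℝ | 0 < t ∧
    n ≤ Set.ncard {k : Fin d → ℤ |
      t ≤ (1 + ∑ j, |(k j : ℝ)| ^ (2 * R j)) ^ (-(1 / 2) : ℝ)}}

theorem sum_exp_neg_mul_rpow_le {p b : ℝ} (hp : 0 < p) (hb : 0 < b) (K : ℕ) :
    ∑ i ∈ Finset.range K, Real.exp (-b * ((i + 1 : ℕ) : ℝ) ^ p)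
      ≤ b ^ (-1 / p) * Real.Gamma (1 / p + 1) := by
  have hanti : AntitoneOn (fun x : ℝ => Real.exp (-b * x ^ p)) (Set.Icc (0 : ℝ) (0 + K)) := by
    intro x hx y hy hxy
    have := Real.rpow_le_rpow hx.1 hxy hp.le
    apply Real.exp_le_exp.2
    nlinarith
  have hint : MeasureTheory.IntegrableOn (fun x : ℝ => Real.exp (-b * x ^ p)) (Set.Ioi 0) := by
    simpa using integrableOn_rpow_mul_exp_neg_mul_rpow (s := 0) (by norm_num) hp hb
  have h := hanti.sum_le_integral
  simp only [zero_add] at h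
  refine h.trans ?_
  rw [← integral_exp_neg_mul_rpow hp hb, intervalIntegral.integral_of_le (Nat.cast_nonneg K)]
  exact MeasureTheory.setIntegral_mono_set hint (.of_forall fun _ ↦ (Real.exp_pos _).le)
    Set.Ioc_subset_Ioi_self.eventuallyLE

theorem div_pow_le_choose (d m : ℕ) (hm : 1 ≤ m) (hmd : m ≤ d) :
    ((d : ℝ) / m) ^ m ≤ d.choose m := by
  induction m, hm using Nat.le_induction generalizing d with
  | base => simp
  | succ m hm ih =>
    obtain ⟨e, rfl⟩ : ∃ e, d = e + 1 := ⟨d - 1, by omega⟩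
    have hme : m ≤ e := by omega
    have h1 := ih e hme
    have hm0 : (0 : ℝ) < m := by exact_mod_cast hm
    have hme' : (m : ℝ) ≤ e := by exact_mod_cast hme
    have h2 : ((e + 1 : ℕ) : ℝ) / (m + 1 : ℕ) ≤ (e : ℝ) / m := by
      push_cast
      rw [div_le_div_iff₀ (by positivity) hm0]
      nlinarith
    have h3 : (((e + 1).choose (m + 1) : ℕ) : ℝ)
        = ((e + 1 : ℕ) : ℝ) / (m + 1 : ℕ) * e.choose m := by
      have := Nat.add_one_mul_choose_eq e m
      have : ((e + 1 : ℕ) : ℝ) * e.choose m = (e + 1).choose (m + 1) * (m + 1 : ℕ) := by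
        exact_mod_cast this
      field_simp
      linarith
    rw [h3, pow_succ']
    gcongr
    exact (pow_le_pow_left₀ (by positivity) h2 m).trans h1

theorem sum_Icc_neg_natAbs (f : ℕ → ℝ) (K : ℕ) :
    ∑ k ∈ Finset.Icc (-(K : ℤ)) K, f k.natAbs
      = f 0 + 2 * ∑ i ∈ Finset.range K, f (i + 1) := by
  have := Finset.sum_Icc_of_even_eq_range (f := fun k : ℤ => f k.natAbs) (fun n => by simp) K
  rw [this, Finset.sum_range_succ']
  simp only [Int.natAbs_natCast, Int.natAbs_zero, Nat.cast_zero, two_nsmul]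
  ring

theorem exists_setOf_sum_rpow_le_subset_piFinset {d : ℕ} {R : Fin d → ℝ}
    (hR : ∀ j, 0 < R j) (T : ℝ) :
    ∃ K : ℕ, {k : Fin d → ℤ | ∑ j, |(k j : ℝ)| ^ (2 * R j) ≤ T} ⊆
      (Fintype.piFinset fun _ : Fin d => Finset.Icc (-(K : ℤ)) K) := by
  obtain ⟨K, hK⟩ := exists_nat_ge (∑ j, |T| ^ (1 / (2 * R j)))
  refine ⟨K, fun k hk => ?_⟩
  simp only [Finset.mem_coe, Fintype.mem_piFinset, Finset.mem_Icc, ← abs_le]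
  intro j
  have h1 : |(k j : ℝ)| ^ (2 * R j) ≤ |T| :=
    ((Finset.single_le_sum (f := fun j => |(k j : ℝ)| ^ (2 * R j))
      (fun i _ => by positivity) (Finset.mem_univ j)).trans hk).trans (le_abs_self T)
  have h2 : |(k j : ℝ)| ≤ |T| ^ (1 / (2 * R j)) := by
    have h := Real.rpow_le_rpow (by positivity) h1 (z := 1 / (2 * R j))
      (by have := hR j; positivity)
    rwa [← Real.rpow_mul (abs_nonneg _), mul_one_div_cancel (by have := hR j; positivity),
      Real.rpow_one] at h
  have h3 := (h2.trans (Finset.single_le_sum (f := fun j => |T| ^ (1 / (2 * R j)))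
    (fun i _ => by positivity) (Finset.mem_univ j))).trans hK
  exact_mod_cast h3

theorem ncard_sum_rpow_le {d : ℕ} {R : Fin d → ℝ} (hR : ∀ j, 0 < R j) {T s : ℝ} (hs : 0 ≤ s)
    {θ : Fin d → ℝ}
    (hθ : ∀ j, ∀ K : ℕ,
      ∑ i ∈ Finset.range K, Real.exp (-s * ((i + 1 : ℕ) : ℝ) ^ (2 * R j)) ≤ θ j) :
    (Set.ncard {k : Fin d → ℤ | ∑ j, |(k j : ℝ)| ^ (2 * R j) ≤ T} : ℝ)
      ≤ Real.exp (s * T) * ∏ j, (1 + 2 * θ j) := by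
  classical
  obtain ⟨K, hK⟩ := exists_setOf_sum_rpow_le_subset_piFinset hR T
  set P := Fintype.piFinset fun _ : Fin d => Finset.Icc (-(K : ℤ)) K with hP
  have hset : {k : Fin d → ℤ | ∑ j, |(k j : ℝ)| ^ (2 * R j) ≤ T}
      = ((P.filter fun k => ∑ j, |(k j : ℝ)| ^ (2 * R j) ≤ T : Finset _) : Set (Fin d → ℤ)) := by
    ext k
    simp only [Set.mem_ofPred_eq, Finset.coe_filter]
    exact ⟨fun h => ⟨hK h, h⟩, fun h => h.2⟩
  rw [hset, Set.ncard_coe_finset, Finset.cast_card]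
  calc ∑ k ∈ P with ∑ j, |(k j : ℝ)| ^ (2 * R j) ≤ T, (1 : ℝ)
      ≤ ∑ k ∈ P with ∑ j, |(k j : ℝ)| ^ (2 * R j) ≤ T,
          Real.exp (s * T) * ∏ j, Real.exp (-s * |(k j : ℝ)| ^ (2 * R j)) := by
        refine Finset.sum_le_sum fun k hk => ?_
        rw [← Real.exp_sum, ← Real.exp_add, ← Finset.mul_sum]
        apply Real.one_le_exp
        nlinarith [(Finset.mem_filter.1 hk).2]
    _ ≤ ∑ k ∈ P, Real.exp (s * T) * ∏ j, Real.exp (-s * |(k j : ℝ)| ^ (2 * R j)) :=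
        Finset.sum_le_sum_of_subset_of_nonneg (Finset.filter_subset _ _)
          fun _ _ _ => by positivity
    _ = Real.exp (s * T) * ∏ j, ∑ k ∈ Finset.Icc (-(K : ℤ)) K,
          Real.exp (-s * |(k : ℝ)| ^ (2 * R j)) := by
        rw [← Finset.mul_sum, Finset.prod_univ_sum]
    _ ≤ _ := by
        gcongr with j
        have h := sum_Icc_neg_natAbs (fun i => Real.exp (-s * (i : ℝ) ^ (2 * R j))) K
        simp only [Nat.cast_natAbs, Int.cast_abs] at h
        rw [h, Nat.cast_zero, Real.zero_rpow (by have := hR j; positivity)]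
        simp only [mul_zero, Real.exp_zero]
        linarith [hθ j K]

theorem finite_setOf_sum_rpow_le {d : ℕ} {R : Fin d → ℝ} (hR : ∀ j, 0 < R j) (T : ℝ) :
    {k : Fin d → ℤ | ∑ j, |(k j : ℝ)| ^ (2 * R j) ≤ T}.Finite := by
  obtain ⟨K, hK⟩ := exists_setOf_sum_rpow_le_subset_piFinset hR T
  exact (Finset.finite_toSet _).subset hK

theorem le_one_of_le_ncard {d : ℕ} {R : Fin d → ℝ} {n : ℕ} (hn : 1 ≤ n) {t : ℝ}
    (h : n ≤ Set.ncard {k : Fin d → ℤ |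
      t ≤ (1 + ∑ j, |(k j : ℝ)| ^ (2 * R j)) ^ (-(1 / 2) : ℝ)}) : t ≤ 1 := by
  obtain ⟨k, hk⟩ := Set.nonempty_of_ncard_ne_zero (by omega : Set.ncard {k : Fin d → ℤ |
      t ≤ (1 + ∑ j, |(k j : ℝ)| ^ (2 * R j)) ^ (-(1 / 2) : ℝ)} ≠ 0)
  have h0 : 0 ≤ ∑ j, |(k j : ℝ)| ^ (2 * R j) := Finset.sum_nonneg fun _ _ => by positivity
  exact le_trans hk (Real.rpow_le_one_of_one_le_of_nonpos (by linarith) (by norm_num))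

theorem sigmaR_le_one {d : ℕ} {R : Fin d → ℝ} {n : ℕ} (hn : 1 ≤ n) : sigmaR d R n ≤ 1 :=
  Real.sSup_le (fun _ ht => le_one_of_le_ncard hn ht.2) zero_le_one

theorem sigmaR_le {d : ℕ} {R : Fin d → ℝ} (hR : ∀ j, 0 < R j) {n : ℕ} {T : ℝ} (hT : 0 < T)
    (h : Set.ncard {k : Fin d → ℤ | ∑ j, |(k j : ℝ)| ^ (2 * R j) ≤ T} < n) :
    sigmaR d R n ≤ T ^ (-(1 / 2) : ℝ) := by
  refine Real.sSup_le (fun t ht => ?_) (by positivity)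
  by_contra! hlt
  refine absurd (ht.2.trans (Set.ncard_le_ncard (fun k hk => ?_)
    (finite_setOf_sum_rpow_le hR T))) (not_le.2 h)
  have h0 : 0 ≤ ∑ j, |(k j : ℝ)| ^ (2 * R j) := Finset.sum_nonneg fun _ _ => by positivity
  have h1 := hlt.trans_le hk
  rw [Real.rpow_lt_rpow_iff_of_neg hT (by linarith) (by norm_num)] at h1
  change ∑ j, |(k j : ℝ)| ^ (2 * R j) ≤ T
  linarith

theorem le_sigmaR {d : ℕ} {R : Fin d → ℝ} (hR : ∀ j, 0 < R j) {n : ℕ} (hn : 1 ≤ n) {T : ℝ}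
    (hT : 0 ≤ T) (F : Finset (Fin d → ℤ)) (hF : n ≤ F.card)
    (hFT : ∀ k ∈ F, ∑ j, |(k j : ℝ)| ^ (2 * R j) ≤ T) :
    (1 + T) ^ (-(1 / 2) : ℝ) ≤ sigmaR d R n := by
  refine le_csSup ⟨1, fun t ht => le_one_of_le_ncard hn ht.2⟩ ⟨by positivity, ?_⟩
  have hsub : {k : Fin d → ℤ |
      (1 + T) ^ (-(1 / 2) : ℝ) ≤ (1 + ∑ j, |(k j : ℝ)| ^ (2 * R j)) ^ (-(1 / 2) : ℝ)}
      = {k : Fin d → ℤ | ∑ j, |(k j : ℝ)| ^ (2 * R j) ≤ T} := by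
    ext k
    have h0 : 0 ≤ ∑ j, |(k j : ℝ)| ^ (2 * R j) := Finset.sum_nonneg fun _ _ => by positivity
    simp only [Set.mem_ofPred_eq]
    rw [Real.rpow_le_rpow_iff_of_neg (by linarith) (by linarith) (by norm_num)]
    simp
  rw [hsub]
  refine hF.trans ?_
  rw [← Set.ncard_coe_finset]
  exact Set.ncard_le_ncard hFT (finite_setOf_sum_rpow_le hR T)

theorem le_sigmaR_of_le_prod {d : ℕ} {R : Fin d → ℝ} (hR : ∀ j, 0 < R j) {n : ℕ} (hn : 1 ≤ n)
    {Y : ℝ} (hY : 0 ≤ Y) (a : Fin d → ℕ) (ha : ∀ j, (a j : ℝ) ^ (2 * R j) ≤ Y)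
    (hna : n ≤ ∏ j, (2 * a j + 1)) :
    (1 + d * Y) ^ (-(1 / 2) : ℝ) ≤ sigmaR d R n := by
  refine le_sigmaR hR hn (by positivity)
    (Fintype.piFinset fun j => Finset.Icc (-(a j : ℤ)) (a j)) ?_ ?_
  · rw [Fintype.card_piFinset]
    convert hna using 2 with j
    rw [Int.card_Icc]
    omega
  · intro k hk
    calc ∑ j, |(k j : ℝ)| ^ (2 * R j) ≤ ∑ _j : Fin d, Y := by
          refine Finset.sum_le_sum fun j _ => le_trans ?_ (ha j)
          have := abs_le.2 (Finset.mem_Icc.1 (Fintype.mem_piFinset.1 hk j))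
          have h2 : |(k j : ℝ)| ≤ a j := by exact_mod_cast this
          exact Real.rpow_le_rpow (abs_nonneg _) h2 (by have := hR j; positivity)
      _ = d * Y := by simp

theorem le_sigmaR_of_le_choose {d : ℕ} {R : Fin d → ℝ} (hR : ∀ j, 0 < R j) {n : ℕ} (hn : 1 ≤ n)
    (m : ℕ) (hm : n ≤ d.choose m) :
    (1 + m : ℝ) ^ (-(1 / 2) : ℝ) ≤ sigmaR d R n := by
  classical
  have hinj : Function.Injective
      (fun (s : Finset (Fin d)) (j : Fin d) => if j ∈ s then (1 : ℤ) else 0) := by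
    intro s t hst
    ext j
    have := congrFun hst j
    by_cases h1 : j ∈ s <;> by_cases h2 : j ∈ t <;> simp_all
  refine le_sigmaR hR hn (Nat.cast_nonneg m)
    ((Finset.powersetCard m (Finset.univ : Finset (Fin d))).map ⟨_, hinj⟩) (by simpa using hm) ?_
  intro k hk
  obtain ⟨s, hs, rfl⟩ := Finset.mem_map.1 hk
  rw [Finset.mem_powersetCard] at hs
  rw [← hs.2, Finset.card_eq_sum_ones, Nat.cast_sum, Nat.cast_one,
    ← Finset.sum_filter_add_sum_filter_not Finset.univ (· ∈ s)]
  refine le_of_eq ?_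
  rw [Finset.sum_eq_zero (s := Finset.univ.filter (· ∉ s)), add_zero]
  · refine Finset.sum_congr (by ext; simp) fun j hj => ?_
    simp [hj]
  · intro j hj
    have hj' : j ∉ s := by simpa using hj
    have := hR j
    simp [hj', Real.zero_rpow, this.ne']

theorem mul_rpow_le_sigmaR {d : ℕ} (hd : 1 ≤ d) {R : Fin d → ℝ} (hR : ∀ j, 0 < R j)
    {n : ℕ} (hn : 1 ≤ n) :
    (2 : ℝ) ^ (-(1 / 2) : ℝ) * (d : ℝ) ^ (-(1 / 2) : ℝ) * (n : ℝ) ^ (-(∑ j, 1 / R j)⁻¹)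
      ≤ sigmaR d R n := by
  have : Nonempty (Fin d) := ⟨⟨0, hd⟩⟩
  have hn1 : (1 : ℝ) ≤ n := by exact_mod_cast hn
  have hd1 : (1 : ℝ) ≤ d := by exact_mod_cast hd
  have hS : 0 < ∑ j, 1 / R j := Finset.sum_pos (fun j _ => one_div_pos.2 (hR j))
    Finset.univ_nonempty
  set g := (∑ j, 1 / R j)⁻¹ with hg
  have hg0 : 0 < g := inv_pos.2 hS
  have hM1 : 1 ≤ (n : ℝ) ^ g := Real.one_le_rpow hn1 hg0.le
  set M := (n : ℝ) ^ g with hM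
  have hM0 : 0 < M := by linarith
  have hprod : ∏ j, M ^ (1 / R j) = n := by
    rw [← Real.rpow_sum_of_pos hM0, hM, ← Real.rpow_mul (by positivity), hg,
      inv_mul_cancel₀ hS.ne', Real.rpow_one]
  have key := le_sigmaR_of_le_prod hR hn (Y := M ^ 2) (by positivity)
    (fun j => ⌊M ^ (1 / R j)⌋₊) (fun j => ?_) ?_
  · refine le_trans ?_ key
    have h1 : (n : ℝ) ^ (-g) = (M ^ 2) ^ (-(1 / 2) : ℝ) := by
      rw [← Real.rpow_natCast, ← Real.rpow_mul hM0.le, Real.rpow_neg (by positivity)]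
      norm_num
      rw [Real.rpow_neg hM0.le, Real.rpow_one]
    rw [h1, ← Real.mul_rpow (by norm_num) (by positivity), ← Real.mul_rpow (by positivity)
      (by positivity)]
    apply Real.rpow_le_rpow_of_nonpos (by positivity) _ (by norm_num)
    nlinarith [one_le_pow₀ hM1 (n := 2)]
  · calc (⌊M ^ (1 / R j)⌋₊ : ℝ) ^ (2 * R j) ≤ (M ^ (1 / R j)) ^ (2 * R j) :=
          Real.rpow_le_rpow (by positivity) (Nat.floor_le (by positivity))
            (by have := hR j; positivity)
      _ = M ^ 2 := by
          rw [← Real.rpow_mul hM0.le, ← Real.rpow_natCast]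
          congr 1
          have := (hR j).ne'
          push_cast
          field_simp
  · have : (n : ℝ) ≤ ∏ j, (2 * (⌊M ^ (1 / R j)⌋₊ : ℝ) + 1) := by
      rw [← hprod]
      refine Finset.prod_le_prod (fun _ _ => by positivity) fun j _ => ?_
      have := Nat.lt_floor_add_one (M ^ (1 / R j))
      have h0 : (0 : ℝ) ≤ ⌊M ^ (1 / R j)⌋₊ := by positivity
      linarith
    exact_mod_cast this

theorem exists_gamma_bound {u v : ℝ} (hv : 0 < v) :
    ∃ G : ℝ, 1 ≤ G ∧ ∀ r ∈ Set.Icc v u, Real.Gamma (1 / (2 * r) + 1) ≤ G := by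
  have hc : ContinuousOn (fun r : ℝ => Real.Gamma (1 / (2 * r) + 1)) (Set.Icc v u) := by
    intro r hr
    have hr0 : 0 < r := hv.trans_le hr.1
    have h0 : 0 < 1 / (2 * r) + 1 := by positivity
    have h1 : ContinuousAt Real.Gamma (1 / (2 * r) + 1) :=
      (Real.differentiableAt_Gamma fun m => by
        have := Nat.cast_nonneg (α := ℝ) m
        linarith).continuousAt
    have h2 : ContinuousAt (fun r : ℝ => 1 / (2 * r) + 1) r := by
      fun_prop (disch := positivity)
    exact (ContinuousAt.comp (f := fun r : ℝ => 1 / (2 * r) + 1) h1 h2).continuousWithinAt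
  obtain ⟨G, hG⟩ := isCompact_Icc.exists_bound_of_continuousOn hc
  exact ⟨max 1 G, le_max_left _ _, fun r hr =>
    (le_abs_self _).trans ((hG r hr).trans (le_max_right _ _))⟩

theorem sum_exp_neg_mul_rpow_le_exp_neg {G r s : ℝ} (hr : 0 < r)
    (hG : Real.Gamma (1 / (2 * r) + 1) ≤ G) (hs : 1 ≤ s) (K : ℕ) :
    ∑ i ∈ Finset.range K, Real.exp (-s * ((i + 1 : ℕ) : ℝ) ^ (2 * r))
      ≤ Real.exp 1 * G * Real.exp (-s) := by
  have h := sum_exp_neg_mul_rpow_le (p := 2 * r) (b := 1) (by positivity) one_pos K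
  rw [Real.one_rpow, one_mul] at h
  calc ∑ i ∈ Finset.range K, Real.exp (-s * ((i + 1 : ℕ) : ℝ) ^ (2 * r))
      ≤ ∑ i ∈ Finset.range K,
          Real.exp 1 * Real.exp (-s) * Real.exp (-1 * ((i + 1 : ℕ) : ℝ) ^ (2 * r)) := by
        refine Finset.sum_le_sum fun i _ => ?_
        rw [← Real.exp_add, ← Real.exp_add, Real.exp_le_exp]
        have : (1 : ℝ) ≤ ((i + 1 : ℕ) : ℝ) ^ (2 * r) :=
          Real.one_le_rpow (by push_cast; linarith [Nat.cast_nonneg (α := ℝ) i]) (by positivity)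
        nlinarith
    _ ≤ Real.exp 1 * Real.exp (-s) * G := by
        rw [← Finset.mul_sum]
        gcongr
        exact h.trans hG
    _ = _ := by ring

theorem half_le_logb_one_add_div {d n : ℕ} (hn : 2 ≤ n) (hnd : n ≤ 3 ^ d) :
    1 / 2 ≤ Real.logb 2 (1 + (d : ℝ) / Real.logb 2 n) := by
  have hn2 : (2 : ℝ) ≤ n := by exact_mod_cast hn
  have hL : 0 < Real.logb 2 n := Real.logb_pos one_lt_two (by linarith)
  have hLd : Real.logb 2 n ≤ 2 * d := by
    rw [Real.logb_le_iff_le_rpow one_lt_two (by linarith), Real.rpow_mul (by norm_num),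
      Real.rpow_natCast]
    calc (n : ℝ) ≤ 3 ^ d := by exact_mod_cast hnd
      _ ≤ _ := by gcongr; norm_num
  have hx : 1 / 2 ≤ (d : ℝ) / Real.logb 2 n := by
    rw [le_div_iff₀ hL]; linarith
  rw [Real.le_logb_iff_rpow_le one_lt_two (by linarith), ← Real.sqrt_eq_rpow]
  refine le_trans ?_ (by linarith : (3 / 2 : ℝ) ≤ _)
  rw [Real.sqrt_le_left (by norm_num)]
  norm_num

theorem exists_sigmaR_le_of_le_three_pow {u v : ℝ} (hv : 0 < v) :
    ∃ c : ℝ, 0 < c ∧ ∀ (d : ℕ) (R : Fin d → ℝ), (∀ j, R j ∈ Set.Icc v u) →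
      ∀ n : ℕ, 2 ≤ n → n ≤ 3 ^ d → sigmaR d R n ≤
        (c * (Real.logb 2 n / Real.logb 2 (1 + (d : ℝ) / Real.logb 2 n))) ^ (-(1 / 2) : ℝ) := by
  obtain ⟨G, hG1, hG⟩ := exists_gamma_bound (u := u) hv
  have he : 1 ≤ Real.exp 1 := Real.one_le_exp zero_le_one
  have hA : Real.exp 1 ≤ 8 * Real.exp 1 * G := by nlinarith
  have ha : 1 ≤ Real.log (8 * Real.exp 1 * G) := by
    rw [Real.le_log_iff_exp_le (by positivity)]; exact hA
  set a := Real.log (8 * Real.exp 1 * G) with ha_def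
  refine ⟨1 / (4 * (1 + 2 * a)), by positivity, fun d R hR n hn hnd => ?_⟩
  have hR0 : ∀ j, 0 < R j := fun j => hv.trans_le (hR j).1
  have hn2 : (2 : ℝ) ≤ n := by exact_mod_cast hn
  have hL : 0 < Real.logb 2 n := Real.logb_pos one_lt_two (by linarith)
  have hl := half_le_logb_one_add_div hn hnd
  have hLn : (n : ℝ) = Real.exp (Real.logb 2 n * Real.log 2) := by
    rw [Real.logb, div_mul_cancel₀ _ (Real.log_pos one_lt_two).ne', Real.exp_log (by linarith)]
  set L := Real.logb 2 n with hL_def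
  set x := (d : ℝ) / L with hx_def
  have hx0 : 0 ≤ x := by positivity
  have hdx : (d : ℝ) = x * L := by rw [hx_def]; field_simp
  have hlx : Real.log (1 + x) = Real.logb 2 (1 + x) * Real.log 2 := by
    rw [Real.logb, div_mul_cancel₀ _ (Real.log_pos one_lt_two).ne']
  set l := Real.logb 2 (1 + x) with hl_def
  have hl0 : 0 < l := by linarith
  set T := 1 / (4 * (1 + 2 * a)) * (L / l) with hT_def
  have hT : 0 < T := by positivity
  apply sigmaR_le hR0 hT
  set s := Real.log (1 + x) + a with hs_def
  have hlog : 0 ≤ Real.log (1 + x) := Real.log_nonneg (by linarith)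
  have hs1 : 1 ≤ s := by linarith
  have hes : Real.exp (-s) = 1 / ((1 + x) * (8 * Real.exp 1 * G)) := by
    rw [Real.exp_neg, hs_def, Real.exp_add, Real.exp_log (by linarith), ha_def,
      Real.exp_log (by positivity), one_div]
  have hN := ncard_sum_rpow_le hR0 (T := T) (s := s) (by linarith)
    (θ := fun _ => Real.exp 1 * G * Real.exp (-s))
    (fun j K => sum_exp_neg_mul_rpow_le_exp_neg (hR0 j) (hG _ (hR j)) hs1 K)
  have hlt : (Set.ncard {k : Fin d → ℤ | ∑ j, |(k j : ℝ)| ^ (2 * R j) ≤ T} : ℝ) < n := by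
    refine hN.trans_lt ?_
    have h1 : ∏ _j : Fin d, (1 + 2 * (Real.exp 1 * G * Real.exp (-s))) ≤ Real.exp (L / 4) := by
      rw [Finset.prod_const, Finset.card_univ, Fintype.card_fin]
      calc (1 + 2 * (Real.exp 1 * G * Real.exp (-s))) ^ d
          ≤ Real.exp (2 * (Real.exp 1 * G * Real.exp (-s))) ^ d := by
            gcongr
            linarith [Real.add_one_le_exp (2 * (Real.exp 1 * G * Real.exp (-s)))]
        _ = Real.exp (d * (2 * (Real.exp 1 * G * Real.exp (-s)))) := (Real.exp_nat_mul _ _).symm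
        _ ≤ Real.exp (L / 4) := by
            rw [Real.exp_le_exp, hes, hdx]
            have : x * L * (2 * (Real.exp 1 * G * (1 / ((1 + x) * (8 * Real.exp 1 * G)))))
                = x * L / (4 * (1 + x)) := by
              field_simp
              ring
            rw [this, div_le_div_iff₀ (by positivity) (by norm_num)]
            nlinarith
    have h2 : s * T ≤ L / 4 := by
      have hlog2 : Real.log 2 ≤ 1 := by linarith [Real.log_two_lt_d9]
      have hs2 : s ≤ (1 + 2 * a) * l := by
        rw [hs_def, hlx]
        nlinarith
      calc s * T ≤ ((1 + 2 * a) * l) * T := by gcongr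
        _ = L / 4 := by rw [hT_def]; field_simp
    calc Real.exp (s * T) * ∏ _j : Fin d, (1 + 2 * (Real.exp 1 * G * Real.exp (-s)))
        ≤ Real.exp (L / 4) * Real.exp (L / 4) := by gcongr
      _ = Real.exp (L / 4 + L / 4) := (Real.exp_add _ _).symm
      _ < n := by
        rw [hLn, Real.exp_lt_exp]
        nlinarith [Real.log_two_gt_d9]
  exact_mod_cast hlt

theorem exists_sigmaR_le_of_three_pow_le {u v : ℝ} (hv : 0 < v) (huv : v ≤ u) :
    ∃ c : ℝ, 0 < c ∧ ∀ (d : ℕ), 1 ≤ d → ∀ (R : Fin d → ℝ), (∀ j, R j ∈ Set.Icc v u) →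
      ∀ n : ℕ, 3 ^ d ≤ n → sigmaR d R n ≤
        c ^ (-(1 / 2) : ℝ) * (d : ℝ) ^ (-(1 / 2) : ℝ) * (n : ℝ) ^ (-(∑ j, 1 / R j)⁻¹) := by
  obtain ⟨G, hG1, hG⟩ := exists_gamma_bound (u := u) hv
  have hu : 0 < u := hv.trans_le huv
  set ρ : ℝ := 3 ^ (v / u) with hρ_def
  have hρ : 1 < ρ := Real.one_lt_rpow (by norm_num) (by positivity)
  have hρi : 1 / ρ < 1 := by rw [div_lt_one (by linarith)]; exact hρ
  set η := (1 - 1 / ρ) / (4 * G) with hη_def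
  have hη : 0 < η := div_pos (by linarith) (by linarith)
  set B := (1 + 1 / η) ^ (2 * u) with hB_def
  have hB1 : 1 ≤ B := Real.one_le_rpow (by linarith [one_div_pos.2 hη]) (by positivity)
  have hBη : B ^ (-1 / (2 * u)) ≤ η := by
    rw [hB_def, ← Real.rpow_mul (by positivity), mul_div_cancel₀ _ (by positivity),
      Real.rpow_neg_one, inv_le_comm₀ (by positivity) hη, ← one_div]
    linarith
  set q := (1 + 1 / ρ) / 2 with hq_def
  have hq0 : 0 < q := by positivity
  have hq1 : q < 1 := by rw [hq_def]; linarith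
  have hlq : Real.log q < 0 := Real.log_neg hq0 hq1
  set c := -Real.log q / (2 * B) with hc_def
  have hc : 0 < c := div_pos (by linarith) (by linarith)
  refine ⟨c, hc, fun d hd R hR n hn => ?_⟩
  have hR0 : ∀ j, 0 < R j := fun j => hv.trans_le (hR j).1
  have : Nonempty (Fin d) := ⟨⟨0, hd⟩⟩
  have hd1 : (1 : ℝ) ≤ d := by exact_mod_cast hd
  have hn3 : (3 : ℝ) ^ d ≤ n := by exact_mod_cast hn
  have hn0 : (0 : ℝ) < n := lt_of_lt_of_le (by positivity) hn3
  have hS : 0 < ∑ j, 1 / R j := Finset.sum_pos (fun j _ => one_div_pos.2 (hR0 j))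
    Finset.univ_nonempty
  have hSd : ∑ j, 1 / R j ≤ d / v := by
    calc ∑ j, 1 / R j ≤ ∑ _j : Fin d, 1 / v :=
          Finset.sum_le_sum fun j _ => one_div_le_one_div_of_le hv (hR j).1
      _ = d / v := by simp [div_eq_mul_inv]
  set g := (∑ j, 1 / R j)⁻¹ with hg
  have hg0 : 0 < g := inv_pos.2 hS
  have hdg : v ≤ d * g := by
    rw [hg, ← div_eq_mul_inv, le_div_iff₀ hS]
    rw [le_div_iff₀ hv] at hSd
    linarith
  set M := (n : ℝ) ^ g with hM
  have hM3 : 3 ^ v ≤ M := by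
    calc (3 : ℝ) ^ v ≤ 3 ^ (d * g) := Real.rpow_le_rpow_of_exponent_le (by norm_num) hdg
      _ = ((3 : ℝ) ^ d) ^ g := by rw [Real.rpow_mul (by norm_num), Real.rpow_natCast]
      _ ≤ M := Real.rpow_le_rpow (by positivity) hn3 hg0.le
  have hM1 : 1 ≤ M := le_trans (Real.one_le_rpow (by norm_num) hv.le) hM3
  have hM0 : 0 < M := by linarith
  have hprod : ∏ j, M ^ (1 / R j) = n := by
    rw [← Real.rpow_sum_of_pos hM0, hM, ← Real.rpow_mul (by positivity), hg,
      inv_mul_cancel₀ hS.ne', Real.rpow_one]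
  have hy : ∀ j, ρ ≤ M ^ (1 / R j) := by
    intro j
    calc ρ = (3 ^ v) ^ (1 / u) := by rw [hρ_def, ← Real.rpow_mul (by norm_num), mul_one_div]
      _ ≤ M ^ (1 / u) := Real.rpow_le_rpow (by positivity) hM3 (by positivity)
      _ ≤ M ^ (1 / R j) := Real.rpow_le_rpow_of_exponent_le hM1
          (one_div_le_one_div_of_le (hR0 j) (hR j).2)
  have hT : 0 < c * d * M ^ 2 := by positivity
  have hgoal : c ^ (-(1 / 2) : ℝ) * (d : ℝ) ^ (-(1 / 2) : ℝ) * (n : ℝ) ^ (-g)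
      = (c * d * M ^ 2) ^ (-(1 / 2) : ℝ) := by
    have h1 : (n : ℝ) ^ (-g) = (M ^ 2) ^ (-(1 / 2) : ℝ) := by
      rw [← Real.rpow_natCast, ← Real.rpow_mul hM0.le, Real.rpow_neg (by positivity)]
      norm_num
      rw [Real.rpow_neg hM0.le, Real.rpow_one]
    rw [h1, ← Real.mul_rpow hc.le (by positivity), ← Real.mul_rpow (by positivity)
      (by positivity)]
  rw [hgoal]
  apply sigmaR_le hR0 hT
  have hθ : ∀ j, ∀ K : ℕ, ∑ i ∈ Finset.range K,
      Real.exp (-(B / M ^ 2) * ((i + 1 : ℕ) : ℝ) ^ (2 * R j)) ≤ η * G * M ^ (1 / R j) := by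
    intro j K
    have hRj := hR0 j
    refine (sum_exp_neg_mul_rpow_le (p := 2 * R j) (b := B / M ^ 2) (by positivity)
      (by positivity) K).trans ?_
    have h1 : (B / M ^ 2) ^ (-1 / (2 * R j)) = B ^ (-1 / (2 * R j)) * M ^ (1 / R j) := by
      rw [Real.div_rpow (by positivity) (by positivity), div_eq_mul_inv,
        ← Real.rpow_neg (by positivity), ← Real.rpow_natCast, ← Real.rpow_mul hM0.le]
      congr 2
      push_cast
      field_simp
    have h2 : B ^ (-1 / (2 * R j)) ≤ η := by
      refine le_trans (Real.rpow_le_rpow_of_exponent_le hB1 ?_) hBη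
      rw [neg_div, neg_div, neg_le_neg_iff]
      exact one_div_le_one_div_of_le (by positivity) (by linarith [(hR j).2])
    rw [h1]
    calc B ^ (-1 / (2 * R j)) * M ^ (1 / R j) * Real.Gamma (1 / (2 * R j) + 1)
        ≤ η * M ^ (1 / R j) * G := by
          have := hG _ (hR j)
          gcongr
      _ = _ := by ring
  have hN := ncard_sum_rpow_le hR0 (T := c * d * M ^ 2) (s := B / M ^ 2) (by positivity) hθ
  have hlt : (Set.ncard {k : Fin d → ℤ |
      ∑ j, |(k j : ℝ)| ^ (2 * R j) ≤ c * d * M ^ 2} : ℝ) < n := by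
    refine hN.trans_lt ?_
    have h1 : ∏ j, (1 + 2 * (η * G * M ^ (1 / R j))) ≤ q ^ d * n := by
      calc ∏ j, (1 + 2 * (η * G * M ^ (1 / R j))) ≤ ∏ j, q * M ^ (1 / R j) := by
            refine Finset.prod_le_prod (fun _ _ => by positivity) fun j _ => ?_
            have h3 : 1 ≤ 1 / ρ * M ^ (1 / R j) := by
              rw [one_div_mul_eq_div, one_le_div (by linarith)]
              exact hy j
            have h4 : 2 * (η * G) = (1 - 1 / ρ) / 2 := by
              rw [hη_def]; field_simp; ring
            calc 1 + 2 * (η * G * M ^ (1 / R j)) = 1 + 2 * (η * G) * M ^ (1 / R j) := by ring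
              _ ≤ 1 / ρ * M ^ (1 / R j) + 2 * (η * G) * M ^ (1 / R j) := by gcongr
              _ = q * M ^ (1 / R j) := by rw [h4, hq_def]; ring
        _ = q ^ d * n := by
            rw [Finset.prod_mul_distrib, hprod]
            simp
    have h2 : B / M ^ 2 * (c * d * M ^ 2) = d * (-Real.log q / 2) := by
      rw [hc_def]; field_simp
    have h3 : Real.exp (d * (-Real.log q / 2)) * q ^ d < 1 := by
      have : q ^ d = Real.exp (d * Real.log q) := by
        rw [Real.exp_nat_mul, Real.exp_log hq0]
      rw [this, ← Real.exp_add, Real.exp_lt_one_iff]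
      nlinarith
    rw [h2]
    calc Real.exp (d * (-Real.log q / 2)) * ∏ j, (1 + 2 * (η * G * M ^ (1 / R j)))
        ≤ Real.exp (d * (-Real.log q / 2)) * (q ^ d * n) := by gcongr
      _ = Real.exp (d * (-Real.log q / 2)) * q ^ d * n := by ring
      _ < n := mul_lt_of_lt_one_left hn0 h3
  exact_mod_cast hlt

theorem le_sigmaR_of_le_three_pow {d : ℕ} {R : Fin d → ℝ} (hR : ∀ j, 0 < R j) {n : ℕ}
    (hdn : d ≤ n) (hn : 2 ≤ n) (hnd : n ≤ 3 ^ d) :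
    (120 * (Real.logb 2 n / Real.logb 2 (1 + (d : ℝ) / Real.logb 2 n))) ^ (-(1 / 2) : ℝ)
      ≤ sigmaR d R n := by
  have hn2 : (2 : ℝ) ≤ n := by exact_mod_cast hn
  have hd : 1 ≤ d := by
    by_contra h
    have : d = 0 := by omega
    subst this
    norm_num at hnd
    omega
  have hd1 : (1 : ℝ) ≤ d := by exact_mod_cast hd
  have hL1 : 1 ≤ Real.logb 2 n := by
    rw [Real.le_logb_iff_rpow_le one_lt_two (by linarith)]; simpa using hn2
  have hl := half_le_logb_one_add_div hn hnd
  have hLn : (n : ℝ) = 2 ^ Real.logb 2 n :=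
    (Real.rpow_logb two_pos (by norm_num) (by linarith)).symm
  have hdL : Real.logb 2 d ≤ Real.logb 2 n :=
    Real.logb_le_logb_of_le one_lt_two (by linarith) (by exact_mod_cast hdn)
  set L := Real.logb 2 n with hL_def
  set x := (d : ℝ) / L with hx_def
  have hx0 : 0 ≤ x := by positivity
  have hdx : (d : ℝ) = x * L := by rw [hx_def]; field_simp
  have h2l : (2 : ℝ) ^ Real.logb 2 (1 + x) = 1 + x :=
    Real.rpow_logb two_pos (by norm_num) (by linarith)
  have hlL : Real.logb 2 (1 + x) ≤ 2 * L := by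
    have h1 : 1 + x ≤ 2 * d := by
      have : x ≤ d := div_le_self (by positivity) hL1
      linarith
    have h2 := Real.logb_le_logb_of_le one_lt_two (by linarith) h1
    rw [Real.logb_mul two_ne_zero (by linarith), Real.logb_self_eq_one one_lt_two] at h2
    linarith
  set l := Real.logb 2 (1 + x) with hl_def
  have hl0 : 0 < l := by linarith
  rcases le_or_gt x 15 with hx | hx
  · have hl4 : l ≤ 4 := by
      rw [hl_def, Real.logb_le_iff_le_rpow one_lt_two (by linarith)]
      have : (2 : ℝ) ^ (4 : ℝ) = 16 := by norm_num
      linarith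
    refine le_trans ?_ (le_sigmaR_of_le_prod hR (by omega) zero_le_one (fun _ => 1)
      (fun j => by simp) (by simpa using hnd))
    apply Real.rpow_le_rpow_of_nonpos (by positivity) _ (by norm_num)
    have h1 : (1 : ℝ) ≤ 4 * (1 / l) := by
      rw [mul_one_div, one_le_div hl0]; exact hl4
    calc 1 + (d : ℝ) * 1 ≤ 30 * L := by nlinarith
      _ ≤ 30 * L * (4 * (1 / l)) := le_mul_of_one_le_right (by positivity) h1
      _ = 120 * (L / l) := by ring
  · have hl4 : 4 ≤ l := by
      rw [hl_def, Real.le_logb_iff_rpow_le one_lt_two (by linarith)]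
      have : (2 : ℝ) ^ (4 : ℝ) = 16 := by norm_num
      linarith
    set m := ⌈2 * L / l⌉₊ with hm_def
    have hLl : 1 ≤ 2 * L / l := by rw [one_le_div hl0]; exact hlL
    have hm1 : 2 * L / l ≤ m := Nat.le_ceil _
    have hm2 : (m : ℝ) ≤ 4 * L / l := by
      have := Nat.ceil_lt_add_one (a := 2 * L / l) (by positivity)
      have h4 : 4 * L / l = 2 * L / l + 2 * L / l := by ring
      linarith
    have hm0 : (1 : ℝ) ≤ m := hLl.trans hm1
    have hdm : x ≤ (d : ℝ) / m := by
      rw [le_div_iff₀ (by linarith), hdx]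
      have : (m : ℝ) ≤ L := by
        refine hm2.trans ?_
        rw [div_le_iff₀ hl0]
        nlinarith
      gcongr
    have hmd : m ≤ d := by
      have : (1 : ℝ) ≤ d / m := by linarith
      rw [one_le_div (by linarith)] at this
      exact_mod_cast this
    have hchoose : n ≤ d.choose m := by
      have h1 := div_pow_le_choose d m (by exact_mod_cast hm0) hmd
      have h2 : (2 : ℝ) ^ (l / 2) ≤ x := by
        have : (2 : ℝ) ^ (l / 2) = √(1 + x) := by
          rw [Real.sqrt_eq_rpow, ← h2l, ← Real.rpow_mul two_pos.le, mul_one_div]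
        rw [this, Real.sqrt_le_left (by linarith)]
        nlinarith
      have h3 : (n : ℝ) ≤ d.choose m := by
        calc (n : ℝ) = 2 ^ L := hLn
          _ ≤ 2 ^ (l / 2 * m) := by
            apply Real.rpow_le_rpow_of_exponent_le one_le_two
            rw [div_le_iff₀ hl0] at hm1
            linarith
          _ = ((2 : ℝ) ^ (l / 2)) ^ m := by rw [Real.rpow_mul two_pos.le, Real.rpow_natCast]
          _ ≤ ((d : ℝ) / m) ^ m := by gcongr; exact h2.trans hdm
          _ ≤ _ := h1
      exact_mod_cast h3
    refine le_trans ?_ (le_sigmaR_of_le_choose hR (by omega) m hchoose)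
    apply Real.rpow_le_rpow_of_nonpos (by positivity) _ (by norm_num)
    have h5 : 4 * L / l = 4 * (L / l) := by ring
    have h6 : 0 ≤ L / l := by positivity
    linarith

theorem mul_div_rpow_neg_half {c L l : ℝ} (hc : 0 < c) (hL : 0 ≤ L) (hl : 0 ≤ l) :
    (c * (L / l)) ^ (-(1 / 2) : ℝ) = c ^ (-(1 / 2) : ℝ) * (l / L) ^ ((1 : ℝ) / 2) := by
  rw [Real.mul_rpow hc.le (by positivity), Real.rpow_neg (by positivity : 0 ≤ L / l),
    ← Real.inv_rpow (by positivity), inv_div]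

/-- for every pair `0 < v ≤ u` there are constants `c, C > 0` depending
only on `u, v` such that for all `d ≥ 1`, all `R` with `min R = v`, `max R = u`,
and all `n ≥ 1`: `σ_{R,d}(n) ≍ 1` for `1 ≤ n ≤ d`,
`σ_{R,d}(n) ≍ (log(1+d/log n)/log n)^{1/2}` for `d ≤ n ≤ 3^d` (base-2 logs), and
`σ_{R,d}(n) ≍ d^{-1/2}·n^{-g(R)}` for `n ≥ 3^d`. -/
theorem stmt_8 (u v : ℝ) (hv : 0 < v) (huv : v ≤ u) :
    ∃ c C : ℝ, 0 < c ∧ 0 < C ∧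
      ∀ d : ℕ, 1 ≤ d → ∀ R : Fin d → ℝ,
        IsLeast (Set.range R) v → IsGreatest (Set.range R) u →
        ∀ n : ℕ, 1 ≤ n →
          ((n ≤ d → c ≤ sigmaR d R n ∧ sigmaR d R n ≤ C) ∧
           (d ≤ n → n ≤ 3 ^ d → 2 ≤ n →
             c * (Real.logb 2 (1 + (d : ℝ) / Real.logb 2 n) / Real.logb 2 n) ^ ((1 : ℝ) / 2)
                 ≤ sigmaR d R n ∧
               sigmaR d R n ≤
                 C * (Real.logb 2 (1 + (d : ℝ) / Real.logb 2 n) / Real.logb 2 n) ^ ((1 : ℝ) / 2)) ∧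
           (3 ^ d ≤ n →
             c * (d : ℝ) ^ (-(1 / 2) : ℝ) * (n : ℝ) ^ (-(∑ j, 1 / R j)⁻¹) ≤ sigmaR d R n ∧
               sigmaR d R n ≤
                 C * (d : ℝ) ^ (-(1 / 2) : ℝ) * (n : ℝ) ^ (-(∑ j, 1 / R j)⁻¹))) := by
  obtain ⟨c₂, hc₂, h₂⟩ := exists_sigmaR_le_of_le_three_pow (u := u) hv
  obtain ⟨c₃, hc₃, h₃⟩ := exists_sigmaR_le_of_three_pow_le hv huv
  have h120 : (120 : ℝ) ^ (-(1 / 2) : ℝ) ≤ 2 ^ (-(1 / 2) : ℝ) :=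
    Real.rpow_le_rpow_of_nonpos two_pos (by norm_num) (by norm_num)
  refine ⟨120 ^ (-(1 / 2) : ℝ), max 1 (max (c₂ ^ (-(1 / 2) : ℝ)) (c₃ ^ (-(1 / 2) : ℝ))),
    by positivity, by positivity, fun d hd R hRv hRu n hn => ?_⟩
  have hR : ∀ j, R j ∈ Set.Icc v u := fun j => ⟨hRv.2 ⟨j, rfl⟩, hRu.2 ⟨j, rfl⟩⟩
  have hR0 : ∀ j, 0 < R j := fun j => hv.trans_le (hR j).1
  refine ⟨fun hnd => ⟨h120.trans ?_, sigmaR_le_one hn |>.trans (le_max_left _ _)⟩,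
    fun hdn hnd hn2 => ?_, fun hnd => ⟨?_, ?_⟩⟩
  · have := le_sigmaR_of_le_choose hR0 hn 1 (by simpa using hnd)
    norm_num at this ⊢
    exact this
  · have hl := half_le_logb_one_add_div hn2 hnd
    have hL : 0 ≤ Real.logb 2 n :=
      Real.logb_nonneg one_lt_two (by exact_mod_cast hn)
    rw [← mul_div_rpow_neg_half (by norm_num) hL (by linarith)]
    refine ⟨le_sigmaR_of_le_three_pow hR0 hdn hn2 hnd, (h₂ d R hR n hn2 hnd).trans ?_⟩
    rw [mul_div_rpow_neg_half hc₂ hL (by linarith)]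
    gcongr
    exact (le_max_left _ _).trans (le_max_right _ _)
  · refine le_trans ?_ (mul_rpow_le_sigmaR hd hR0 hn)
    gcongr
  · refine (h₃ d hd R hR n hnd).trans ?_
    gcongr
    exact (le_max_right _ _).trans (le_max_right _ _)
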